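/- Let F ∈ R^{l×m} (l ≤ m) be of full row rank, where R = K[x_1,...,x_n]. If J_l(F) = R, then F admits a zero prime factorization F = G · F_1 with G ∈ R^{l×l}, F_1 ∈ R^{l×m}, det G associated to d_l(F), and F_1 a zero left prime (ZLP) matrix. -/

import Mathlib

open Matrix MvPolynomial

/-- The set of `k × k` minors of a matrix: determinants of submatrices obtained by
choosing `k` rows and `k` columns. -/
def minorsSet {R : Type*} [CommRing R] {l m : ℕ} (k : ℕ)
    (F : Matrix (Fin l) (Fin m) R) : Set R :=
  { d | ∃ (ri : Fin k → Fin l) (ci : Fin k → Fin m),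
      Function.Injective ri ∧ Function.Injective ci ∧ d = (F.submatrix ri ci).det }

/-- `d` is a greatest common divisor of the `k × k` minors of `F`. -/
def IsGcdMinors {R : Type*} [CommRing R] {l m : ℕ} (k : ℕ)
    (F : Matrix (Fin l) (Fin m) R) (d : R) : Prop :=
  (∀ a ∈ minorsSet k F, d ∣ a) ∧ ∀ e : R, (∀ a ∈ minorsSet k F, e ∣ a) → e ∣ d

/-- `J_k(F) = R` : the ideal generated by the reduced `k`-th order minors
(the `k × k` minors divided by their g.c.d.) is the unit ideal. -/
def JEqTop {R : Type*} [CommRing R] {l m : ℕ} (k : ℕ)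
    (F : Matrix (Fin l) (Fin m) R) : Prop :=
  ∃ d : R, IsGcdMinors k F d ∧ Ideal.span { b : R | d * b ∈ minorsSet k F } = ⊤

/-- The normal rank of a polynomial matrix: its rank over the fraction field. -/
noncomputable def normalRank {K : Type*} [Field K] {n l m : ℕ}
    (F : Matrix (Fin l) (Fin m) (MvPolynomial (Fin n) K)) : ℕ :=
  (F.map (algebraMap (MvPolynomial (Fin n) K)
      (FractionRing (MvPolynomial (Fin n) K)))).rank

/-- Equivalence of matrices: `G = M * F * N` with `M`, `N` unimodular
(i.e. with determinant a unit, a nonzero constant). -/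
def MatEquiv {R : Type*} [CommRing R] {l m : ℕ}
    (F G : Matrix (Fin l) (Fin m) R) : Prop :=
  ∃ (M : Matrix (Fin l) (Fin l) R) (N : Matrix (Fin m) (Fin m) R),
    IsUnit M.det ∧ IsUnit N.det ∧ G = M * F * N

/-- A matrix is zero left prime (ZLP) if its maximal (row-size) order minors
generate the unit ideal. -/
def ZLP {R : Type*} [CommRing R] {l m : ℕ} (F : Matrix (Fin l) (Fin m) R) : Prop :=
  Ideal.span (minorsSet l F) = ⊤

section VecEquiv

variable {R S ι : Type*} [CommRing R] [CommRing S] [Fintype ι]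

/-- Two column vectors are equivalent if an invertible matrix carries one to the other. -/
def VecEquiv [DecidableEq ι] (v w : ι → R) : Prop :=
  ∃ M : (Matrix ι ι R)ˣ, (M : Matrix ι ι R) *ᵥ v = w

/-- A vector is unimodular if some linear combination of its entries is `1`. -/
def IsUnimodular (v : ι → R) : Prop :=
  ∃ g : ι → R, g ⬝ᵥ v = 1

theorem IsUnimodular.map {v : ι → R} (f : R →+* S) :
    IsUnimodular v → IsUnimodular (f ∘ v) := by
  rintro ⟨g, hg⟩
  exact ⟨f ∘ g, by rw [← RingHom.map_dotProduct, hg, map_one]⟩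

theorem IsUnimodular.exists_isUnit [IsLocalRing R] {v : ι → R} (h : IsUnimodular v) :
    ∃ i, IsUnit (v i) := by
  obtain ⟨g, hg⟩ := h
  by_contra! hv
  have : g ⬝ᵥ v ∈ IsLocalRing.maximalIdeal R :=
    Ideal.sum_mem _ fun i _ => Ideal.mul_mem_left _ _ (hv i)
  rw [hg] at this
  exact (IsLocalRing.mem_maximalIdeal _).1 this isUnit_one

namespace VecEquiv

variable [DecidableEq ι]

theorem refl (v : ι → R) : VecEquiv v v := ⟨1, by simp⟩

theorem symm {v w : ι → R} : VecEquiv v w → VecEquiv w v := by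
  rintro ⟨M, rfl⟩
  exact ⟨M⁻¹, by simp [mulVec_mulVec]⟩

theorem trans {u v w : ι → R} : VecEquiv u v → VecEquiv v w → VecEquiv u w := by
  rintro ⟨M, rfl⟩ ⟨N, rfl⟩
  exact ⟨N * M, by simp [mulVec_mulVec]⟩

theorem map {v w : ι → R} (f : R →+* S) :
    VecEquiv v w → VecEquiv (f ∘ v) (f ∘ w) := by
  rintro ⟨M, rfl⟩
  refine ⟨Units.map f.mapMatrix.toMonoidHom M, ?_⟩
  ext i
  simp [RingHom.map_mulVec]

theorem isUnimodular {v w : ι → R} : VecEquiv v w → IsUnimodular v → IsUnimodular w := by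
  rintro ⟨M, rfl⟩ ⟨g, hg⟩
  refine ⟨g ᵥ* (M⁻¹ : (Matrix ι ι R)ˣ), ?_⟩
  rw [dotProduct_mulVec, vecMul_vecMul]
  simpa using hg

/-- Adding multiples of one entry to the other entries. -/
theorem add_mul (v c : ι → R) (i : ι) (hc : c i = 0) :
    VecEquiv v (fun j => v j + c j * v i) := by
  have h : ∀ c : ι → R, c i = 0 →
      (1 + vecMulVec c (Pi.single i 1)) * (1 + vecMulVec (-c) (Pi.single i 1)) =
        (1 : Matrix ι ι R) := by
    intro c hc
    simp [_root_.mul_add, _root_.add_mul, vecMulVec_mul_vecMulVec, hc]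
  refine ⟨⟨_, _, h c hc, by simpa using h (-c) (by simp [hc])⟩, ?_⟩
  ext j
  simp [add_mulVec, vecMulVec_mulVec, mul_comm]

theorem reindex (v : ι → R) (σ : Equiv.Perm ι) : VecEquiv v (v ∘ σ) := by
  refine ⟨⟨(1 : Matrix ι ι R).submatrix σ id, (1 : Matrix ι ι R).submatrix id σ, ?_, ?_⟩, ?_⟩
  · rw [← submatrix_mul _ _ σ id σ Function.bijective_id]
    simp
  · rw [submatrix_mul_equiv]
    simp
  · ext j
    simp [mulVec, dotProduct, one_apply]

theorem smul (v : ι → R) (u : Rˣ) : VecEquiv v (fun j => u * v j) := by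
  refine ⟨Units.map (Matrix.scalar ι).toMonoidHom u, ?_⟩
  ext j
  simp [mulVec_diagonal]

theorem of_isUnit {v : ι → R} {i : ι} (h : IsUnit (v i)) (i₀ : ι) :
    VecEquiv v (Pi.single i₀ 1) := by
  obtain ⟨u, hu⟩ := h
  refine (smul v u⁻¹).trans ((add_mul _ (fun j => if j = i then 0 else -(u⁻¹ * v j)) i
    (by simp)).trans ?_)
  refine (reindex _ (Equiv.swap i i₀)).trans ?_
  convert refl (Pi.single i₀ (1 : R)) using 1
  ext j
  rcases eq_or_ne j i₀ with rfl | hj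
  · simp [← hu]
  · have : Equiv.swap i i₀ j ≠ i := by
      intro h
      rw [Equiv.swap_apply_eq_iff] at h
      simp at h
      exact hj h
    simp [this, hj, ← hu]

end VecEquiv

end VecEquiv

section Horrocks

variable {A ι : Type*} [CommRing A] [IsLocalRing A]

open scoped Polynomial

/-- If `f` is monic of degree `d` and `g` has degree less than `d` and a unit coefficient, then some
combination of `f` and `g` has degree less than `d` and a unit as coefficient of degree `d - 1`. -/
theorem exists_combination_isUnit_coeff {f : A[X]} {d : ℕ} (hf : f.Monic)
    (hd : f.natDegree = d + 1) :
    ∀ (e : ℕ) (g : A[X]), g.degree < (d + 1 : ℕ) → ∀ s, s + e = d → IsUnit (g.coeff s) →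
      ∃ a b : A[X], (a * f + b * g).degree < (d + 1 : ℕ) ∧ IsUnit ((a * f + b * g).coeff d) := by
  intro e
  induction e with
  | zero =>
    rintro g hg s rfl hs
    exact ⟨0, 1, by simpa using hg, by simpa using hs⟩
  | succ e ih =>
    intro g hg s hs hu
    by_cases hgd : IsUnit (g.coeff d)
    · exact ⟨0, 1, by simpa using hg, by simpa using hgd⟩
    obtain ⟨a, b, h1, h2⟩ := ih (Polynomial.X * g - Polynomial.C (g.coeff d) * f) (by
      rw [Polynomial.degree_lt_iff_coeff_zero]
      intro m hm
      obtain ⟨m, rfl⟩ : ∃ k, m = k + 1 := ⟨m - 1, by omega⟩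
      rw [Polynomial.coeff_sub, Polynomial.coeff_X_mul, Polynomial.coeff_C_mul]
      rcases eq_or_lt_of_le (show d ≤ m by omega) with rfl | hlt
      · have : f.coeff (d + 1) = 1 := by rw [← hd]; exact hf
        simp [this]
      · rw [Polynomial.coeff_eq_zero_of_natDegree_lt (show f.natDegree < m + 1 by omega),
          (Polynomial.degree_lt_iff_coeff_zero _ _).1 hg m (by omega)]
        simp) (s + 1) (by omega) (by
      rw [Polynomial.coeff_sub, Polynomial.coeff_X_mul, Polynomial.coeff_C_mul]
      by_contra hn
      have h1 : g.coeff s - g.coeff d * f.coeff (s + 1) ∈ IsLocalRing.maximalIdeal A := hn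
      have h2 : g.coeff d * f.coeff (s + 1) ∈ IsLocalRing.maximalIdeal A :=
        Ideal.mul_mem_right _ _ hgd
      have h3 := Ideal.add_mem _ h1 h2
      rw [sub_add_cancel] at h3
      exact h3 hu)
    refine ⟨a - b * Polynomial.C (g.coeff d), b * Polynomial.X, ?_⟩
    have : (a - b * Polynomial.C (g.coeff d)) * f + b * Polynomial.X * g =
      a * f + b * (Polynomial.X * g - Polynomial.C (g.coeff d) * f) := by ring
    rw [this]
    exact ⟨h1, h2⟩

variable [Fintype ι]

theorem exists_isUnit_coeff_of_isUnimodular {v : ι → A[X]} {i : ι} (hm : (v i).Monic)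
    (hd : (v i).natDegree ≠ 0) (hv : IsUnimodular v) :
    ∃ j ≠ i, ∃ s, IsUnit ((v j).coeff s) := by
  by_contra! h
  obtain ⟨g, hg⟩ := hv.map (Polynomial.mapRingHom (IsLocalRing.residue A))
  have h0 : ∀ j ≠ i, (v j).map (IsLocalRing.residue A) = 0 := by
    intro j hj
    ext s
    simpa using h j hj s
  rw [dotProduct, Finset.sum_eq_single i (fun j _ hj => by simp [h0 j hj]) (by simp)] at hg
  have hu : IsUnit ((v i).map (IsLocalRing.residue A)) := IsUnit.of_mul_eq_one_right _ hg
  have := congrArg Polynomial.natDegree ((hm.map (IsLocalRing.residue A)).isUnit_iff.1 hu)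
  rw [hm.natDegree_map, Polynomial.natDegree_one] at this
  exact hd this

variable [DecidableEq ι]

theorem VecEquiv.of_card_eq_two {R : Type*} [CommRing R] {v : ι → R} (hv : IsUnimodular v)
    {i j : ι} (hij : j ≠ i) (h : ∀ k, k = i ∨ k = j) : VecEquiv v (Pi.single i 1) := by
  obtain ⟨g, hg⟩ := hv
  have hs : ∀ f : ι → R, ∑ k, f k = f i + f j := by
    intro f
    rw [← Finset.sum_pair hij.symm]
    congr 1
    ext k
    simpa using h k
  simp only [dotProduct, hs] at hg
  have hE : ∀ M N : Matrix ι ι R, M i i = N i i → M i j = N i j → M j i = N j i →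
      M j j = N j j → M = N := by
    intro M N h1 h2 h3 h4
    ext a b
    rcases h a with rfl | rfl <;> rcases h b with rfl | rfl <;> assumption
  refine ⟨⟨.of fun p q => if p = i then g q else if q = i then - v j else v i,
    .of fun p q => if q = i then v p else if p = i then - g j else g i, ?_, ?_⟩, ?_⟩
  · apply hE <;> simp [mul_apply, hs, hij, hij.symm] <;> first | ring1 | linear_combination hg
  · apply hE <;> simp [mul_apply, hs, hij, hij.symm] <;> first | ring1 | linear_combination hg
  · ext k
    rcases h k with rfl | rfl
    · simpa [mulVec, dotProduct, hs] using hg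
    · simp [mulVec, dotProduct, hs, hij]
      ring

theorem VecEquiv.of_isLocalRing (d : ℕ) : ∀ (v : ι → A[X]) (i : ι), (v i).Monic →
    (v i).natDegree = d → IsUnimodular v → ∀ i₀, VecEquiv v (Pi.single i₀ 1) := by
  induction d with
  | zero =>
    intro v i hm hd hv i₀
    exact VecEquiv.of_isUnit (i := i) (by simp [Polynomial.eq_one_of_monic_natDegree_zero hm hd]) i₀
  | succ d ih =>
    intro v i hm hd hv i₀
    have h1 : VecEquiv v (fun j => if j = i then v i else v j %ₘ v i) := by
      convert VecEquiv.add_mul v (fun j => if j = i then 0 else - (v j /ₘ v i)) i (by simp) using 2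
        with j
      split_ifs with h
      · simp [h]
      · rw [Polynomial.modByMonic_eq_sub_mul_div]
        ring
    refine h1.trans ?_
    replace hv := h1.isUnimodular hv
    clear h1
    obtain ⟨w, hw⟩ : ∃ w, w = fun j => if j = i then v i else v j %ₘ v i := ⟨_, rfl⟩
    have hwi : w i = v i := by simp [hw]
    rw [← hw] at hv ⊢
    have hlt : ∀ j ≠ i, (w j).degree < (d + 1 : ℕ) := by
      intro j hj
      simp only [hw, hj, if_false]
      have := Polynomial.degree_modByMonic_lt (v j) hm
      rwa [Polynomial.degree_eq_natDegree hm.ne_zero, hd] at this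
    rw [← hwi] at hm hd
    clear hw hwi v
    obtain ⟨j, hji, s, hs⟩ := exists_isUnit_coeff_of_isUnimodular hm (by omega) hv
    by_cases h2 : ∀ k, k = i ∨ k = j
    · refine (VecEquiv.of_card_eq_two hv hji h2).trans ?_
      exact VecEquiv.of_isUnit (i := i) (by simp) i₀
    push Not at h2
    obtain ⟨k, hki, hkj⟩ := h2
    have hsd : s < d + 1 := by
      by_contra hsd
      rw [(Polynomial.degree_lt_iff_coeff_zero _ _).1 (hlt j hji) s (by omega)] at hs
      exact not_isUnit_zero hs
    obtain ⟨a, b, hab, u, hu⟩ := exists_combination_isUnit_coeff hm hd (d - s) (w j) (hlt j hji) s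
      (by omega) hs
    obtain ⟨c, hc⟩ : ∃ c : A, c = (1 - (w k).coeff d) * ↑u⁻¹ := ⟨_, rfl⟩
    have e1 := VecEquiv.add_mul w (Pi.single k (Polynomial.C c * a)) i (by simp [hki.symm])
    refine e1.trans ?_
    have e2 := VecEquiv.add_mul
      (fun x => w x + (Pi.single k (Polynomial.C c * a) : ι → A[X]) x * w i)
      (Pi.single k (Polynomial.C c * b)) j (by simp [hkj.symm])
    refine e2.trans ?_
    have hlast : w k + Polynomial.C c * a * w i + Polynomial.C c * b * w j =
        w k + Polynomial.C c * (a * w i + b * w j) := by ring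
    have hcoeff : (w k + Polynomial.C c * (a * w i + b * w j)).coeff d = 1 := by
      rw [Polynomial.coeff_add, Polynomial.coeff_C_mul, ← hu, hc]
      simp
    have hdeg : (w k + Polynomial.C c * (a * w i + b * w j)).degree < (d + 1 : ℕ) := by
      refine (Polynomial.degree_add_le _ _).trans_lt (max_lt (hlt k hki) ?_)
      rw [Polynomial.degree_lt_iff_coeff_zero] at hab ⊢
      intro N hN
      rw [Polynomial.coeff_C_mul, hab N hN, mul_zero]
    have hle : (w k + Polynomial.C c * (a * w i + b * w j)).natDegree ≤ d := by
      rw [Polynomial.natDegree_le_iff_coeff_eq_zero]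
      exact fun N hN => (Polynomial.degree_lt_iff_coeff_zero _ _).1 hdeg N hN
    have hmon := Polynomial.monic_of_natDegree_le_of_coeff_eq_one d
      hle hcoeff
    refine ih _ k ?_ ?_ (e2.isUnimodular (e1.isUnimodular hv)) i₀
    · simp [hkj.symm, hlast, hmon]
    · simp only [Pi.single_eq_same, Pi.single_eq_of_ne hkj.symm, zero_mul, add_zero, hlast]
      exact Polynomial.natDegree_eq_of_le_of_coeff_ne_zero hle (by simp [hcoeff])

end Horrocks

section LocalGlobal

open scoped Polynomial

variable {A B ι : Type*} [CommRing A] [CommRing B] [Fintype ι] [DecidableEq ι]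

/-- The substitution `X ↦ X + c Y`, from `A[X]` to `A[X][Y]`. -/
noncomputable def shiftBy (c : A) : A[X] →+* A[X][X] :=
  Polynomial.eval₂RingHom (Polynomial.C.comp Polynomial.C)
    (Polynomial.C Polynomial.X + Polynomial.C (Polynomial.C c) * Polynomial.X)

/-- The substitution `Y ↦ c Y` on `A[X][Y]`. -/
noncomputable def scaleBy (c : A) : A[X][X] →+* A[X][X] :=
  Polynomial.eval₂RingHom Polynomial.C (Polynomial.C (Polynomial.C c) * Polynomial.X)

theorem scaleBy_comp_shiftBy (a c : A) : (scaleBy a).comp (shiftBy c) = shiftBy (a * c) := by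
  refine Polynomial.ringHom_ext (fun b => ?_) ?_ <;> simp [shiftBy, scaleBy]
  ring

theorem shiftBy_zero : shiftBy (0 : A) = Polynomial.C := by
  ext <;> simp [shiftBy]

theorem mapRingHom_comp_shiftBy (f : A →+* B) (c : A) :
    (Polynomial.mapRingHom (Polynomial.mapRingHom f)).comp (shiftBy c) =
      (shiftBy (f c)).comp (Polynomial.mapRingHom f) := by
  ext <;> simp [shiftBy]

theorem mapRingHom_comp_scaleBy (f : A →+* B) (c : A) :
    (Polynomial.mapRingHom (Polynomial.mapRingHom f)).comp (scaleBy c) =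
      (scaleBy (f c)).comp (Polynomial.mapRingHom (Polynomial.mapRingHom f)) := by
  ext <;> simp [scaleBy]

/-- The elements `c` such that `v(X)` and `v(X + c Y)` are equivalent form an ideal. -/
noncomputable def quillenIdeal (v : ι → A[X]) : Ideal A where
  carrier := { c | VecEquiv (Polynomial.C ∘ v) (shiftBy c ∘ v) }
  zero_mem' := by
    simpa [shiftBy_zero] using VecEquiv.refl _
  add_mem' := by
    intro a b ha hb
    have := VecEquiv.map (Polynomial.eval₂RingHom (shiftBy b) Polynomial.X) ha
    refine VecEquiv.trans hb ?_
    convert this using 1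
    · ext1 i
      simp
    · rw [← Function.comp_assoc, ← RingHom.coe_comp]
      congr 2
      refine Polynomial.ringHom_ext (fun b => ?_) ?_ <;> simp [shiftBy]
      ring
  smul_mem' := by
    intro a b hb
    have := VecEquiv.map (scaleBy a) hb
    rw [← Function.comp_assoc, ← Function.comp_assoc, ← RingHom.coe_comp, ← RingHom.coe_comp,
      scaleBy_comp_shiftBy] at this
    have h : (scaleBy a).comp Polynomial.C = Polynomial.C := by ext <;> simp [scaleBy]
    rwa [h] at this

theorem mem_quillenIdeal {v : ι → A[X]} {c : A} :
    c ∈ quillenIdeal v ↔ VecEquiv (Polynomial.C ∘ v) (shiftBy c ∘ v) := Iff.rfl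

theorem VecEquiv.of_quillenIdeal_eq_top {v : ι → A[X]} (h : quillenIdeal v = ⊤) :
    VecEquiv v (fun i => Polynomial.C ((v i).eval 0)) := by
  have h1 : (1 : A) ∈ quillenIdeal v := h ▸ Submodule.mem_top
  rw [mem_quillenIdeal] at h1
  refine VecEquiv.symm ?_
  convert h1.map (Polynomial.eval₂RingHom
    (Polynomial.C.comp (Polynomial.evalRingHom (0 : A))) Polynomial.X) using 1
  · ext1 i
    simp
  · rw [← Function.comp_assoc, ← RingHom.coe_comp]
    convert (Function.id_comp v).symm using 2
    rw [← RingHom.coe_id]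
    congr 1
    ext <;> simp [shiftBy]

theorem exists_mul_mem_range_mapRingHom {A' B' : Type*} [CommRing A'] [CommRing B'] (f : A' →+* B')
    (g : A →+* A') (S : Submonoid A) (h : ∀ b : B', ∃ s ∈ S, f (g s) * b ∈ f.range) (p : B'[X]) :
    ∃ s ∈ S, Polynomial.mapRingHom f (Polynomial.C (g s)) * p ∈
      (Polynomial.mapRingHom f).range := by
  induction p using Polynomial.induction_on' with
  | add p q hp hq =>
    obtain ⟨s, hs, hp⟩ := hp
    obtain ⟨t, ht, hq⟩ := hq
    refine ⟨s * t, S.mul_mem hs ht, ?_⟩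
    have := Subring.add_mem _ (Subring.mul_mem _ (RingHom.mem_range_self
        (Polynomial.mapRingHom f) (Polynomial.C (g t))) hp)
      (Subring.mul_mem _ (RingHom.mem_range_self
        (Polynomial.mapRingHom f) (Polynomial.C (g s))) hq)
    convert this using 1
    simp only [map_mul]
    ring
  | monomial n b =>
    obtain ⟨s, hs, a, ha⟩ := h b
    exact ⟨s, hs, Polynomial.monomial n a, by simp [ha, Polynomial.C_mul_monomial]⟩

theorem exists_scaleBy_mem_range (S : Submonoid A) [Algebra A B] [IsLocalization S B]
    (p : B[X][X]) (hp : p.coeff 0 ∈ (Polynomial.mapRingHom (algebraMap A B)).range) :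
    ∃ s ∈ S, ∀ t, s ∣ t → scaleBy (algebraMap A B t) p ∈
      (Polynomial.mapRingHom (Polynomial.mapRingHom (algebraMap A B))).range := by
  obtain ⟨s, hs, q, hq⟩ := exists_mul_mem_range_mapRingHom
    (Polynomial.mapRingHom (algebraMap A B)) Polynomial.C S
    (exists_mul_mem_range_mapRingHom (algebraMap A B) (RingHom.id A) S (by
      intro b
      obtain ⟨⟨a, s⟩, h⟩ := IsLocalization.surj S b
      exact ⟨s, s.2, a, by rw [← h, mul_comm]; rfl⟩)) p.divX
  refine ⟨s, hs, ?_⟩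
  rintro _ ⟨t, rfl⟩
  obtain ⟨r, hr⟩ := hp
  refine ⟨scaleBy (s * t) q * Polynomial.C (Polynomial.C t) * Polynomial.X + Polynomial.C r, ?_⟩
  have h1 := congrArg (fun f => f q) (mapRingHom_comp_scaleBy (algebraMap A B) (s * t))
  simp only [RingHom.comp_apply] at h1
  conv_rhs => rw [← Polynomial.divX_mul_X_add p]
  simp only [map_add, map_mul, h1, hq]
  rw [← hr]
  simp [scaleBy]
  ring

theorem exists_mem_quillenIdeal [IsDomain A] {v : ι → A[X]} (S : Submonoid A) [Algebra A B]
    [IsLocalization S B] (hS : S ≤ nonZeroDivisors A) {w : ι → B}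
    (h : VecEquiv (Polynomial.mapRingHom (algebraMap A B) ∘ v) (Polynomial.C ∘ w)) :
    ∃ s ∈ S, s ∈ quillenIdeal v := by
  obtain ⟨M, hM⟩ := h
  obtain ⟨φ, hφ⟩ : ∃ φ, φ = Polynomial.mapRingHom (Polynomial.mapRingHom (algebraMap A B)) :=
    ⟨_, rfl⟩
  have hinj : Function.Injective φ := hφ ▸ Polynomial.map_injective _
    (Polynomial.map_injective _ (IsLocalization.injective B hS))
  obtain ⟨G, hG⟩ : ∃ G : (Matrix ι ι B[X][X])ˣ,
    G = (Units.map (shiftBy (1 : B)).mapMatrix.toMonoidHom M)⁻¹ *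
      Units.map (Polynomial.C : B[X] →+* B[X][X]).mapMatrix.toMonoidHom M := ⟨_, rfl⟩
  have hG0 : Units.map (Polynomial.evalRingHom (0 : B[X])).mapMatrix.toMonoidHom G = 1 := by
    have : (Polynomial.evalRingHom (0 : B[X])).comp (shiftBy 1) =
      (Polynomial.evalRingHom (0 : B[X])).comp Polynomial.C := by
      ext <;> simp [shiftBy]
    rw [hG, map_mul, map_inv, inv_mul_eq_one]
    ext1
    ext1 i j
    exact congrArg (fun f => f (M.1 i j)) this
  have hGv : (G : Matrix ι ι B[X][X]) *ᵥ (φ ∘ Polynomial.C ∘ v) =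
      shiftBy 1 ∘ Polynomial.mapRingHom (algebraMap A B) ∘ v := by
    have h1 : (M.1.map (Polynomial.C : B[X] →+* B[X][X])) *ᵥ (φ ∘ Polynomial.C ∘ v) =
        (M.1.map (shiftBy (1 : B))) *ᵥ
          (shiftBy 1 ∘ Polynomial.mapRingHom (algebraMap A B) ∘ v) := by
      have e1 : φ ∘ Polynomial.C ∘ v =
          Polynomial.C ∘ Polynomial.mapRingHom (algebraMap A B) ∘ v := by
        ext1 i
        simp [hφ]
      rw [e1]
      ext1 i
      have e2 := congrArg Polynomial.C (congrFun hM i)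
      have e3 := congrArg (shiftBy (1 : B)) (congrFun hM i)
      rw [RingHom.map_mulVec] at e2 e3
      refine e2.trans (Eq.trans ?_ e3.symm)
      simp [shiftBy]
    rw [hG, Units.val_mul, ← mulVec_mulVec]
    have h2 : (Units.map (Polynomial.C : B[X] →+* B[X][X]).mapMatrix.toMonoidHom M).1 =
      M.1.map (Polynomial.C : B[X] →+* B[X][X]) := rfl
    have h3 : (Units.map (shiftBy (1 : B)).mapMatrix.toMonoidHom M).1 =
      M.1.map (shiftBy (1 : B)) := rfl
    rw [h2, h1, ← h3, mulVec_mulVec, Units.inv_mul, one_mulVec]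
  have key : ∀ N : (Matrix ι ι B[X][X]),
      N.map (Polynomial.evalRingHom (0 : B[X])) = 1 →
        ∃ s ∈ S, ∀ t, s ∣ t → ∃ N' : Matrix ι ι A[X][X],
        N'.map φ = N.map (scaleBy (algebraMap A B t)) := by
    intro N hN
    have : ∀ x : ι × ι, ∃ s ∈ S, ∀ t, s ∣ t → scaleBy (algebraMap A B t) (N x.1 x.2) ∈ φ.range := by
      intro x
      rw [hφ]
      refine exists_scaleBy_mem_range S (N x.1 x.2) ?_
      have := congrFun (congrFun hN x.1) x.2
      rw [map_apply, Polynomial.coe_evalRingHom, ← Polynomial.coeff_zero_eq_eval_zero, one_apply]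
        at this
      rw [this]
      split_ifs
      · exact Subring.one_mem _
      · exact Subring.zero_mem _
    choose s hs hs' using this
    refine ⟨∏ x, s x, S.prod_mem fun x _ => hs x, fun t ht => ?_⟩
    choose N' hN' using fun x => hs' x t ((Finset.dvd_prod_of_mem s (Finset.mem_univ x)).trans ht)
    refine ⟨.of fun i j => N' (i, j), ?_⟩
    ext1 i j
    exact hN' (i, j)
  obtain ⟨s, hs, hs'⟩ := key G (congrArg Units.val hG0)
  obtain ⟨t, ht, ht'⟩ := key (G⁻¹ : (Matrix ι ι B[X][X])ˣ) (by
    have := congrArg Units.val (congrArg (·⁻¹) hG0)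
    simpa [← map_inv] using this)
  obtain ⟨G', hG'⟩ := hs' (s * t) ⟨t, rfl⟩
  obtain ⟨H', hH'⟩ := ht' (s * t) ⟨s, mul_comm _ _⟩
  have hinj' : Function.Injective (fun N : Matrix ι ι A[X][X] => N.map φ) :=
    Matrix.map_injective hinj
  refine ⟨s * t, S.mul_mem hs ht, ⟨G', H', hinj' ?_, hinj' ?_⟩, ?_⟩
  · simp only [Matrix.map_mul, hG', hH']
    rw [← Matrix.map_mul]
    simp
  · simp only [Matrix.map_mul, hG', hH']
    rw [← Matrix.map_mul]
    simp
  · refine hinj.comp_left ?_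
    have : φ ∘ (G' *ᵥ (Polynomial.C ∘ v)) = (G'.map φ) *ᵥ (φ ∘ Polynomial.C ∘ v) := by
      ext1 i
      exact RingHom.map_mulVec _ _ _ _
    refine this.trans ?_
    rw [hG']
    have e1 : φ ∘ Polynomial.C ∘ v =
        scaleBy (algebraMap A B (s * t)) ∘ φ ∘ Polynomial.C ∘ v := by
      ext1 i
      simp [hφ, scaleBy]
    have e2 := congrArg (scaleBy (algebraMap A B (s * t)) ∘ ·) hGv
    rw [e1]
    convert e2 using 1
    · ext1 i
      exact (RingHom.map_mulVec _ _ _ _).symm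
    · have h1 := scaleBy_comp_shiftBy (algebraMap A B (s * t)) 1
      rw [mul_one] at h1
      simp only [← Function.comp_assoc, ← RingHom.coe_comp]
      rw [← RingHom.comp_assoc, h1, hφ, ← mapRingHom_comp_shiftBy]

theorem VecEquiv.of_monic [IsDomain A] {v : ι → A[X]} (hv : IsUnimodular v) {i : ι}
    (hi : (v i).Monic) : VecEquiv v (fun i => Polynomial.C ((v i).eval 0)) := by
  refine VecEquiv.of_quillenIdeal_eq_top ?_
  by_contra hne
  obtain ⟨m, hm, hle⟩ := Ideal.exists_le_maximal _ hne
  have := hm.isPrime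
  obtain ⟨s, hs, hs'⟩ := exists_mem_quillenIdeal (B := Localization.AtPrime m) (v := v)
    (w := Pi.single i 1) m.primeCompl m.primeCompl_le_nonZeroDivisors (by
      convert VecEquiv.of_isLocalRing _ (Polynomial.mapRingHom (algebraMap A
        (Localization.AtPrime m)) ∘ v) i (hi.map _) rfl (hv.map _) i using 1
      ext1 j
      by_cases h : j = i <;> simp [h])
  exact hs (hle hs')

end LocalGlobal

namespace NagataShift

section

open Polynomial MvPolynomial Ideal Nat RingHom List

variable {k : Type*} [Field k] {n : ℕ} (f : MvPolynomial (Fin (n + 1)) k)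
variable (v w : Fin (n + 1) →₀ ℕ)

variable {f v} in
lemma lt_up (vlt : ∀ i, v i < (2 + f.totalDegree)) : ∀ l ∈ ofFn v, l < (2 + f.totalDegree) := by
  grind

/-- We construct an algebra map `T1 f c` which maps `X_i` into `X_i + c • X_0 ^ r_i` when `i ≠ 0`
and `X_0` to `X_0`. -/
noncomputable abbrev T1 (c : k) :
    MvPolynomial (Fin (n + 1)) k →ₐ[k] MvPolynomial (Fin (n + 1)) k :=
  aeval fun i ↦ if i = 0 then X 0 else
    X i + c • X 0 ^ (fun (i : Fin (n + 1)) ↦ (2 + f.totalDegree) ^ i.1) i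

lemma t1_comp_t1_neg (c : k) : (T1 f c).comp (T1 f (-c)) = AlgHom.id _ _ := by
  rw [comp_aeval, ← MvPolynomial.aeval_X_left]
  ext i v
  cases i using Fin.cases <;> simp

/-- `T1 f 1` leads to an algebra equiv `T f`. -/
noncomputable abbrev T := AlgEquiv.ofAlgHom (T1 f 1) (T1 f (-1))
  (t1_comp_t1_neg f 1) (by simpa using t1_comp_t1_neg f (-1))

lemma sum_r_mul_ne (vlt : ∀ i, v i < (2 + f.totalDegree)) (wlt : ∀ i, w i < (2 + f.totalDegree))
    (ne : v ≠ w) :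
    ∑ x : Fin (n + 1), (fun (i : Fin (n + 1)) ↦ (2 + f.totalDegree) ^ i.1) x * v x ≠
      ∑ x : Fin (n + 1), (fun (i : Fin (n + 1)) ↦ (2 + f.totalDegree) ^ i.1) x * w x := by
  intro h
  refine ne <| Finsupp.ext <| congrFun <| ofFn_inj.mp ?_
  apply ofDigits_inj_of_len_eq (Nat.lt_add_right f.totalDegree one_lt_two)
    (by simp) (lt_up vlt) (lt_up wlt)
  simpa only [ofDigits_eq_sum_mapIdx, mapIdx_eq_ofFn, get_ofFn, length_ofFn,
    Fin.val_cast, mul_comm, sum_ofFn] using! h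

lemma degreeOf_zero_t {a : k} (ha : a ≠ 0) : ((T f) (monomial v a)).degreeOf 0 =
    ∑ i : Fin (n + 1), ((fun (i : Fin (n + 1)) ↦ (2 + f.totalDegree) ^ i.1) i) * v i := by
  rw [← natDegree_finSuccEquiv, monomial_eq, Finsupp.prod_pow v fun a ↦ X a]
  simp only [Fin.prod_univ_succ, Fin.sum_univ_succ, map_mul, map_prod, map_pow,
    AlgEquiv.ofAlgHom_apply, MvPolynomial.aeval_C, MvPolynomial.aeval_X, if_pos, Fin.succ_ne_zero,
    ite_false, one_smul, map_add, finSuccEquiv_X_zero, finSuccEquiv_X_succ, algebraMap_eq]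
  have h (i : Fin n) :
      (Polynomial.C (X (R := k) i) +
        Polynomial.X ^ (fun (i : Fin (n + 1)) ↦ (2 + f.totalDegree) ^ i.1) i.succ) ^ v i.succ ≠ 0 :=
    pow_ne_zero (v i.succ) (leadingCoeff_ne_zero.mp <| by simp [add_comm, leadingCoeff_X_pow_add_C])
  rw [natDegree_mul (by simp [ha]) (mul_ne_zero (by simp) (Finset.prod_ne_zero_iff.mpr
    (fun i _ ↦ h i))), natDegree_mul (by simp) (Finset.prod_ne_zero_iff.mpr (fun i _ ↦ h i)),
    natDegree_prod _ _ (fun i _ ↦ h i), natDegree_finSuccEquiv, degreeOf_C]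
  simpa only [natDegree_pow, zero_add, natDegree_X, mul_one, Fin.val_zero, pow_zero, one_mul,
    add_right_inj] using Finset.sum_congr rfl (fun i _ ↦ by
    rw [add_comm (Polynomial.C _), natDegree_X_pow_add_C, mul_comm])

/-- `T` maps different monomials of `f` to polynomials with different degrees in `X_0`. -/
lemma degreeOf_t_ne_of_ne (hv : v ∈ f.support) (hw : w ∈ f.support) (ne : v ≠ w) :
    (T f <| monomial v <| coeff v f).degreeOf 0 ≠
    (T f <| monomial w <| coeff w f).degreeOf 0 := by
  rw [degreeOf_zero_t _ _ <| mem_support_iff.mp hv, degreeOf_zero_t _ _ <| mem_support_iff.mp hw]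
  refine sum_r_mul_ne f v w (fun i ↦ ?_) (fun i ↦ ?_) ne <;>
  exact lt_of_le_of_lt ((monomial_le_degreeOf i ‹_›).trans (degreeOf_le_totalDegree f i))
    (by lia)

lemma leadingCoeff_finSuccEquiv_t :
    (finSuccEquiv k n ((T f) ((monomial v) (coeff v f)))).leadingCoeff =
    algebraMap k _ (coeff v f) := by
  rw [monomial_eq, Finsupp.prod_fintype]
  · simp only [map_mul, map_prod, leadingCoeff_mul, leadingCoeff_prod]
    rw [AlgEquiv.ofAlgHom_apply, algHom_C, algebraMap_eq, finSuccEquiv_apply,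
      eval₂Hom_C, coe_comp]
    simp only [AlgEquiv.ofAlgHom_apply, Function.comp_apply, leadingCoeff_C, map_pow,
      leadingCoeff_pow, algebraMap_eq]
    have : ∀ j, ((finSuccEquiv k n) ((T1 f) 1 (X j))).leadingCoeff = 1 := fun j ↦ by
      by_cases h : j = 0
      · simp [h, finSuccEquiv_apply]
      · simp only [aeval_eq_bind₁, bind₁_X_right, if_neg h, one_smul, map_add, map_pow]
        obtain ⟨i, rfl⟩ := Fin.exists_succ_eq.mpr h
        simp [finSuccEquiv_X_succ, finSuccEquiv_X_zero, add_comm]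
    simp only [this, one_pow, Finset.prod_const_one, mul_one]
  exact fun i ↦ pow_zero _

/-- `T` maps `f` into some polynomial in `X_0` such that the leading coefficient is invertible. -/
lemma T_leadingcoeff_isUnit (fne : f ≠ 0) :
    IsUnit (finSuccEquiv k n (T f f)).leadingCoeff := by
  obtain ⟨v, vin, vs⟩ := Finset.exists_max_image f.support
    (fun v ↦ (T f ((monomial v) (coeff v f))).degreeOf 0) (support_nonempty.mpr fne)
  set h := fun w ↦ (MvPolynomial.monomial w) (coeff w f)
  simp only [← natDegree_finSuccEquiv] at vs
  replace vs : ∀ x ∈ f.support \ {v}, (finSuccEquiv k n ((T f) (h x))).degree <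
      (finSuccEquiv k n ((T f) (h v))).degree := by
    intro x hx
    obtain ⟨h1, h2⟩ := Finset.mem_sdiff.mp hx
    apply degree_lt_degree <| lt_of_le_of_ne (vs x h1) ?_
    simpa only [natDegree_finSuccEquiv]
      using degreeOf_t_ne_of_ne f _ _ h1 vin <| ne_of_not_mem_cons h2
  have coeff : (finSuccEquiv k n ((T f) (h v + ∑ x ∈ f.support \ {v}, h x))).leadingCoeff =
      (finSuccEquiv k n ((T f) (h v))).leadingCoeff := by
    simp only [map_add, map_sum]
    rw [add_comm]
    apply leadingCoeff_add_of_degree_lt <| (lt_of_le_of_lt <| degree_sum_le _ _) ?_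
    have h2 : h v ≠ 0 := by simpa [h] using mem_support_iff.mp vin
    replace h2 : (finSuccEquiv k n ((T f) (h v))) ≠ 0 := fun eq ↦ h2 <|
      by simpa only [map_eq_zero_iff _ (AlgEquiv.injective _)] using eq
    exact (Finset.sup_lt_iff <| Ne.bot_lt (fun x ↦ h2 <| degree_eq_bot.mp x)).mpr vs
  nth_rw 2 [← f.support_sum_monomial_coeff]
  rw [Finset.sum_eq_add_sum_sdiff_singleton_of_mem vin h]
  rw [leadingCoeff_finSuccEquiv_t] at coeff
  simpa only [coeff, algebraMap_eq] using (mem_support_iff.mp vin).isUnit.map MvPolynomial.C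

end

end NagataShift

section UnimodularVectors

variable {ι : Type*} [Fintype ι] [DecidableEq ι]

theorem VecEquiv.of_ringEquiv {R S : Type*} [CommRing R] [CommRing S] (e : R ≃+* S) {v w : ι → R}
    (h : VecEquiv (e ∘ v) (e ∘ w)) : VecEquiv v w := by
  convert h.map (e.symm : S →+* R) using 1 <;> ext1 i <;> simp

/-- Every unimodular vector over a polynomial ring over a field is equivalent to a standard basis
vector. -/
theorem IsUnimodular.vecEquiv_single {K : Type*} [Field K] (n : ℕ) :
    ∀ {v : ι → MvPolynomial (Fin n) K}, IsUnimodular v → ∀ i₀, VecEquiv v (Pi.single i₀ 1) := by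
  induction n with
  | zero =>
    intro v hv i₀
    have : IsLocalRing (MvPolynomial (Fin 0) K) :=
      (MvPolynomial.isEmptyAlgEquiv K (Fin 0)).symm.toRingEquiv.isLocalRing
    obtain ⟨i, hi⟩ := hv.exists_isUnit
    exact VecEquiv.of_isUnit hi i₀
  | succ n ih =>
    intro v hv i₀
    obtain ⟨i, hi⟩ : ∃ i, v i ≠ 0 := by
      by_contra! h
      obtain ⟨g, hg⟩ := hv
      simp [dotProduct, h] at hg
    have hu := NagataShift.T_leadingcoeff_isUnit (v i) hi
    obtain ⟨e, he⟩ : ∃ e : MvPolynomial (Fin (n + 1)) K ≃+* Polynomial (MvPolynomial (Fin n) K),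
        e = ((NagataShift.T (v i)).trans (finSuccEquiv K n)).toRingEquiv := ⟨_, rfl⟩
    refine VecEquiv.of_ringEquiv e ?_
    have hu : IsUnit (e (v i)).leadingCoeff := by simpa [he] using hu
    obtain ⟨u, hu⟩ := hu
    replace hv := hv.map (e : MvPolynomial (Fin (n + 1)) K →+* Polynomial (MvPolynomial (Fin n) K))
    have h1 := VecEquiv.smul (e ∘ v) (Units.map Polynomial.C.toMonoidHom u⁻¹)
    refine h1.trans ?_
    replace hv := h1.isUnimodular hv
    have h2 := VecEquiv.of_monic hv (i := i) (by
      have : ((↑u⁻¹ : MvPolynomial (Fin n) K) • e (v i)).Monic := by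
        have := Polynomial.monic_of_isUnit_leadingCoeff_inv_smul (p := e (v i)) (hu ▸ u.isUnit)
        convert this using 2
        ext1
        simp [← hu, Units.smul_def]
      rw [Polynomial.smul_eq_C_mul] at this
      exact this)
    refine h2.trans ?_
    have h3 := (ih (hv.map (Polynomial.evalRingHom 0)) i₀).map Polynomial.C
    convert h3 using 1 <;> ext1 j <;> by_cases h : j = i₀ <;> simp [h]

end UnimodularVectors

section Splitting

variable {R : Type*} [CommRing R]

theorem nonempty_prod_equiv_of_exact {K E M : Type*} [AddCommGroup K] [AddCommGroup E]
    [AddCommGroup M] [Module R K] [Module R E] [Module R M] [Module.Projective R M]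
    {i : K →ₗ[R] E} {p : E →ₗ[R] M} (hi : Function.Injective i) (hip : Function.Exact i p)
    (hp : Function.Surjective p) : Nonempty ((K × M) ≃ₗ[R] E) := by
  obtain ⟨s, hs⟩ := LinearMap.exists_rightInverse_of_surjective p (LinearMap.range_eq_top.2 hp)
  have hs' : ∀ m, p (s m) = m := fun m => LinearMap.congr_fun hs m
  have hpi : ∀ k, p (i k) = 0 := hip.apply_apply_eq_zero
  refine ⟨LinearEquiv.ofBijective (i.coprod s) ⟨?_, ?_⟩⟩
  · rw [injective_iff_map_eq_zero]
    rintro ⟨k, m⟩ h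
    simp only [LinearMap.coprod_apply] at h
    have h1 := congrArg p h
    rw [map_add, hpi, hs', map_zero, zero_add] at h1
    subst h1
    rw [map_zero, add_zero, map_eq_zero_iff i hi] at h
    rw [h]
    rfl
  · intro e
    obtain ⟨k, hk⟩ := (hip (e - s (p e))).1 (by simp [hs'])
    exact ⟨(k, p e), by simp [hk]⟩

/-- **Schanuel's lemma**. -/
theorem schanuel {K M K' M' N : Type*} [AddCommGroup K] [AddCommGroup M] [AddCommGroup K']
    [AddCommGroup M'] [AddCommGroup N] [Module R K] [Module R M] [Module R K'] [Module R M']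
    [Module R N] [Module.Projective R M] [Module.Projective R M']
    {i : K →ₗ[R] M} {f : M →ₗ[R] N} {i' : K' →ₗ[R] M'} {f' : M' →ₗ[R] N}
    (hi : Function.Injective i) (hif : Function.Exact i f) (hf : Function.Surjective f)
    (hi' : Function.Injective i') (hif' : Function.Exact i' f') (hf' : Function.Surjective f') :
    Nonempty ((K × M') ≃ₗ[R] (K' × M)) := by
  have h0 := hif.apply_apply_eq_zero
  have h0' := hif'.apply_apply_eq_zero
  let E := LinearMap.ker (f.coprod (-f'))
  have hE : ∀ x : E, f x.1.1 = f' x.1.2 := by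
    rintro ⟨⟨x, y⟩, h⟩
    simpa [E, ← sub_eq_add_neg, sub_eq_zero] using h
  let j : K →ₗ[R] E := ((LinearMap.inl R M M').comp i).codRestrict E (fun k => by simp [E, h0])
  let j' : K' →ₗ[R] E := ((LinearMap.inr R M M').comp i').codRestrict E (fun k => by simp [E, h0'])
  obtain ⟨e⟩ := nonempty_prod_equiv_of_exact (i := j) (p := (LinearMap.snd R M M').comp E.subtype)
    (fun a b h => hi (congrArg (fun x : E => x.1.1) h)) (by
      intro x
      constructor
      · intro hx
        have hx : x.1.2 = 0 := hx
        obtain ⟨k, hk⟩ := (hif x.1.1).1 (by rw [hE, hx, map_zero])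
        exact ⟨k, Subtype.ext (Prod.ext hk hx.symm)⟩
      · rintro ⟨k, rfl⟩
        rfl) (by
      intro y
      obtain ⟨x, hx⟩ := hf (f' y)
      exact ⟨⟨(x, y), by simp [E, hx]⟩, rfl⟩)
  obtain ⟨e'⟩ := nonempty_prod_equiv_of_exact (i := j') (p := (LinearMap.fst R M M').comp E.subtype)
    (fun a b h => hi' (congrArg (fun x : E => x.1.2) h)) (by
      intro x
      constructor
      · intro hx
        have hx : x.1.1 = 0 := hx
        obtain ⟨k, hk⟩ := (hif' x.1.2).1 (by rw [← hE, hx, map_zero])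
        exact ⟨k, Subtype.ext (Prod.ext hx.symm hk)⟩
      · rintro ⟨k, rfl⟩
        rfl) (by
      intro x
      obtain ⟨y, hy⟩ := hf' (f x)
      exact ⟨⟨(x, y), by simp [E, hy]⟩, rfl⟩)
  exact ⟨e.trans e'.symm⟩

theorem Module.Projective.of_prod_left {M N : Type*} [AddCommGroup M] [AddCommGroup N] [Module R M]
    [Module R N] [Module.Projective R (M × N)] : Module.Projective R M :=
  Module.Projective.of_split (LinearMap.inl R M N) (LinearMap.fst R M N)
    (LinearMap.fst_comp_inl R M N)

theorem Module.Projective.restrictScalars (A : Type*) {D M : Type*} [CommRing A] [CommRing D]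
    [Algebra A D] [AddCommGroup M] [Module A M] [Module D M] [IsScalarTower A D M]
    [Module.Free A D] [Module.Projective D M] : Module.Projective A M := by
  obtain ⟨s, hs⟩ := Module.Projective.out (R := D) (P := M)
  exact Module.Projective.of_split (M := M →₀ D) (s.restrictScalars A)
    ((Finsupp.linearCombination D id).restrictScalars A) (LinearMap.ext hs)

theorem Module.Projective.eq_zero_of_smul_eq_zero {D M : Type*} [CommRing D]
    [AddCommGroup M] [Module D M] [Module.Projective D M] {f : D} (hf : f ∈ nonZeroDivisors D)
    {x : M} (h : f • x = 0) : x = 0 := by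
  obtain ⟨s, hs⟩ := Module.Projective.out (R := D) (P := M)
  have h1 : s x = 0 := by
    ext m
    have := congrArg (fun y => y m) (congrArg s h)
    simp only [map_smul, map_zero, Finsupp.smul_apply, Finsupp.zero_apply, smul_eq_mul] at this
    simpa using (mul_right_mem_nonZeroDivisors_eq_zero_iff hf).1 (by rwa [mul_comm] at this)
  rw [← hs x, h1, map_zero]

/-- A module over a ring on which unimodular vectors are equivalent to standard basis vectors is
free as soon as its sum with the ring is free. -/
theorem Module.Free.of_prod_self {D : Type*} [CommRing D] [Nontrivial D]
    (hD : ∀ (n : ℕ) (v : Fin n → D), IsUnimodular v → ∀ i, VecEquiv v (Pi.single i 1))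
    {P : Type*} [AddCommGroup P] [Module D P] [Module.Finite D P] [Module.Free D (P × D)] :
    Module.Free D P := by
  obtain ⟨n, ⟨b⟩⟩ : ∃ n, Nonempty ((P × D) ≃ₗ[D] (Fin n → D)) :=
    ⟨_, ⟨(Module.finBasis D (P × D)).equivFun⟩⟩
  have hv : IsUnimodular (b (0, 1)) := by
    refine ⟨fun i => (b.symm (Pi.single i 1)).2, ?_⟩
    have h := congrArg Prod.snd (b.symm_apply_apply (0, 1))
    rw [pi_eq_sum_univ' (b (0, 1)), map_sum, Prod.snd_sum] at h
    refine Eq.trans ?_ h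
    simp [dotProduct, mul_comm]
  obtain ⟨i⟩ : Nonempty (Fin n) := by
    by_contra h
    rw [not_nonempty_iff] at h
    obtain ⟨g, hg⟩ := hv
    simp [dotProduct] at hg
  obtain ⟨M, hM⟩ := hD n _ hv i
  let e : (Fin n → D) ≃ₗ[D] (Fin n → D) := LinearEquiv.ofLinearMap M.1.mulVecLin (M⁻¹).1.mulVecLin
    (by rw [← mulVecLin_mul]; simp) (by rw [← mulVecLin_mul]; simp)
  let Φ : (P × D) ≃ₗ[D] (Fin n → D) := b.trans e
  have hΦ : Φ (0, 1) = Pi.single i 1 := hM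
  have hΦc : ∀ c : D, Φ (0, c) = c • Pi.single i 1 := by
    intro c
    rw [← hΦ, ← map_smul]
    simp
  let ψ : P →ₗ[D] ({j // j ≠ i} → D) :=
    (LinearMap.funLeft D D Subtype.val).comp (Φ.toLinearMap.comp (LinearMap.inl D P D))
  have hψ : ∀ p j, ψ p j = Φ (p, 0) j.1 := fun _ _ => rfl
  refine Module.Free.of_equiv (LinearEquiv.ofBijective ψ ⟨?_, ?_⟩).symm
  · rw [injective_iff_map_eq_zero]
    intro p hp
    have : Φ (p, 0) = Φ (0, Φ (p, 0) i) := by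
      rw [hΦc]
      ext j
      by_cases h : j = i
      · simp [h]
      · rw [Pi.smul_apply, Pi.single_eq_of_ne h, smul_zero]
        exact congrFun hp ⟨j, h⟩
    exact congrArg Prod.fst (Φ.injective this)
  · intro w
    let w' : Fin n → D := fun j => if h : j = i then 0 else w ⟨j, h⟩
    refine ⟨(Φ.symm w').1, ?_⟩
    ext ⟨j, hj⟩
    have h1 : Φ ((Φ.symm w').1, 0) + Φ (0, (Φ.symm w').2) = w' := by
      rw [← map_add]
      simp
    rw [hΦc] at h1
    have h2 := congrFun h1 j
    simp only [Pi.add_apply, Pi.smul_apply, Pi.single_eq_of_ne hj, smul_zero, add_zero] at h2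
    rw [hψ, h2]
    simp [w', hj]

end Splitting

section CharacteristicSequence

variable {A : Type*} [CommRing A] {k s t : ℕ}

/-- The vector of `j`-th coefficients of a vector of polynomials. -/
def coeffVec (j : ℕ) (u : Fin k → Polynomial A) : Fin k → A := fun i => (u i).coeff j

/-- A vector of constants, seen as a vector of polynomials. -/
noncomputable def constVec (x : Fin k → A) : Fin k → Polynomial A := fun i => Polynomial.C (x i)

/-- Extension of scalars to polynomials of a linear map between spaces of vectors. -/
noncomputable def polyExtend (L : (Fin k → A) →ₗ[A] (Fin s → A)) :
    (Fin k → Polynomial A) →ₗ[Polynomial A] (Fin s → Polynomial A) :=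
  Matrix.toLin' ((LinearMap.toMatrix' L).map Polynomial.C)

theorem polyExtend_constVec (L : (Fin k → A) →ₗ[A] (Fin s → A)) (x : Fin k → A) :
    polyExtend L (constVec x) = constVec (L x) := by
  ext1 i
  rw [polyExtend, toLin'_apply]
  conv_rhs => rw [← LinearMap.toMatrix'_mulVec L x]
  exact (RingHom.map_mulVec Polynomial.C (LinearMap.toMatrix' L) x i).symm

theorem coeffVec_polyExtend (L : (Fin k → A) →ₗ[A] (Fin s → A)) (j : ℕ) (u : Fin k → Polynomial A) :
    coeffVec j (polyExtend L u) = L (coeffVec j u) := by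
  rw [← LinearMap.toMatrix'_mulVec L]
  ext i
  simp [polyExtend, coeffVec, mulVec, dotProduct, Polynomial.finsetSum_coeff]

theorem polyExtend_comp (L : (Fin s → A) →ₗ[A] (Fin t → A)) (L' : (Fin k → A) →ₗ[A] (Fin s → A)) :
    polyExtend (L.comp L') = (polyExtend L).comp (polyExtend L') := by
  simp [polyExtend, LinearMap.toMatrix'_comp, ← toLin'_mul]

theorem coeffVec_ext {u v : Fin k → Polynomial A} (h : ∀ j, coeffVec j u = coeffVec j v) :
    u = v := by
  ext i j
  exact congrFun (h j) i

theorem polyExtend_injective {L : (Fin k → A) →ₗ[A] (Fin s → A)} (hL : Function.Injective L) :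
    Function.Injective (polyExtend L) := fun u v h =>
  coeffVec_ext fun j => hL (by rw [← coeffVec_polyExtend, h, coeffVec_polyExtend])

theorem exists_forall_coeffVec_eq_zero (u : Fin k → Polynomial A) :
    ∃ n, ∀ j, n ≤ j → coeffVec j u = 0 := by
  refine ⟨∑ i, ((u i).natDegree + 1), fun j hj => ?_⟩
  ext i
  refine Polynomial.coeff_eq_zero_of_natDegree_lt ?_
  have := Finset.single_le_sum (f := fun i => (u i).natDegree + 1) (fun _ _ => Nat.zero_le _)
    (Finset.mem_univ i)
  omega

theorem eq_sum_constVec {u : Fin k → Polynomial A} {n : ℕ} (h : ∀ j, n ≤ j → coeffVec j u = 0) :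
    u = ∑ j ∈ Finset.range n, (Polynomial.X ^ j : Polynomial A) • constVec (coeffVec j u) := by
  ext i j
  simp only [Finset.sum_apply, Pi.smul_apply, smul_eq_mul, Polynomial.finsetSum_coeff, constVec,
    Polynomial.coeff_X_pow_mul', Polynomial.coeff_C]
  rcases lt_or_ge j n with hj | hj
  · rw [Finset.sum_eq_single_of_mem j (Finset.mem_range.2 hj)]
    · simp [coeffVec]
    · intro c _ hc
      rcases lt_or_ge j c with h1 | h1
      · rw [if_neg (by omega)]
      · rw [if_pos h1, if_neg (by omega)]
  · rw [Finset.sum_eq_zero]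
    · exact congrFun (h j hj) i
    · intro c hc
      have := Finset.mem_range.1 hc
      rw [if_pos (by omega), if_neg (by omega)]

theorem exists_eq_constVec_add (T : (Fin k → A) →ₗ[A] (Fin k → A)) (u : Fin k → Polynomial A) :
    ∃ a x, u = constVec a + ((Polynomial.X : Polynomial A) • x - polyExtend T x) := by
  have hc : ∀ (j : ℕ) (a : Fin k → A), ∃ b x, (Polynomial.X ^ j : Polynomial A) • constVec a =
      constVec b + ((Polynomial.X : Polynomial A) • x - polyExtend T x) := by
    intro j
    induction j with
    | zero => exact fun a => ⟨a, 0, by simp⟩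
    | succ j ih =>
      intro a
      obtain ⟨b, x, h⟩ := ih (T a)
      refine ⟨b, x + (Polynomial.X ^ j : Polynomial A) • constVec a, ?_⟩
      rw [smul_add, map_add, map_smul, polyExtend_constVec, h, smul_smul, ← pow_succ']
      abel
  obtain ⟨n, hn⟩ := exists_forall_coeffVec_eq_zero u
  choose b x h using fun j => hc j (coeffVec j u)
  refine ⟨∑ j ∈ Finset.range n, b j, ∑ j ∈ Finset.range n, x j, ?_⟩
  conv_lhs => rw [eq_sum_constVec hn]
  rw [Finset.sum_congr rfl fun j _ => h j, Finset.sum_add_distrib, Finset.sum_sub_distrib, map_sum,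
    Finset.smul_sum]
  congr 1
  ext1 i
  simp [constVec]

theorem constVec_single (i : Fin k) : (constVec (Pi.single i 1) : Fin k → Polynomial A) =
    Pi.single i 1 := by
  ext1 j
  by_cases h : j = i <;> simp [constVec, h]

/-- A module over a polynomial ring `A[X]` with a free resolution of length one over `A` has a free
resolution of length two over `A[X]`. -/
theorem exists_polynomial_resolution {N : Type*} [AddCommGroup N] [Module A N]
    [Module (Polynomial A) N] [IsScalarTower A (Polynomial A) N]
    {ε : (Fin k → A) →ₗ[A] N} (hε : Function.Surjective ε)
    {B : (Fin s → A) →ₗ[A] (Fin k → A)} (hB : Function.Injective B) (hBε : Function.Exact B ε) :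
    ∃ (ρ : (Fin k → Polynomial A) →ₗ[Polynomial A] N)
      (φ : ((Fin s → Polynomial A) × (Fin k → Polynomial A)) →ₗ[Polynomial A]
        (Fin k → Polynomial A))
      (i : (Fin s → Polynomial A) →ₗ[Polynomial A]
        ((Fin s → Polynomial A) × (Fin k → Polynomial A))),
      Function.Surjective ρ ∧ Function.Exact φ ρ ∧ Function.Exact i φ ∧ Function.Injective i := by
  have hεB : ∀ x, ε (B x) = 0 := hBε.apply_apply_eq_zero
  obtain ⟨T, hT⟩ := Module.projective_lifting_property ε
    ((LinearMap.restrictScalars A (LinearMap.lsmul (Polynomial A) N Polynomial.X)).comp ε) hε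
  replace hT : ∀ x, ε (T x) = (Polynomial.X : Polynomial A) • ε x := LinearMap.congr_fun hT
  obtain ⟨T', hT'⟩ : ∃ T' : (Fin s → A) →ₗ[A] (Fin s → A), B.comp T' = T.comp B := by
    obtain ⟨T', h⟩ := Module.projective_lifting_property B.rangeRestrict
      ((T.comp B).codRestrict (LinearMap.range B) fun x => (hBε _).1 (by simp [hT, hεB]))
      B.surjective_rangeRestrict
    exact ⟨T', LinearMap.ext fun x => congrArg Subtype.val (LinearMap.congr_fun h x)⟩
  let ρ := Fintype.linearCombination (Polynomial A) (fun i : Fin k => ε (Pi.single i 1))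
  have hρ : ∀ x, ρ (constVec x) = ε x := by
    intro x
    conv_rhs => rw [← LinearMap.sum_single_apply (fun _ => A) x, map_sum]
    rw [Fintype.linearCombination_apply]
    refine Finset.sum_congr rfl fun i _ => ?_
    rw [constVec, ← Polynomial.algebraMap_eq, algebraMap_smul, ← map_smul, ← Pi.single_smul]
    simp
  let X : Polynomial A := Polynomial.X
  let BB := polyExtend B
  let D := X • LinearMap.id - polyExtend T
  let D' := X • LinearMap.id - polyExtend T'
  have hD : BB.comp D' = D.comp BB := by
    simp only [D, D', BB, LinearMap.comp_sub, LinearMap.sub_comp, ← polyExtend_comp, hT']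
    simp [LinearMap.comp_smul, LinearMap.smul_comp]
  have hρD : ρ.comp D = 0 := by
    refine LinearMap.pi_ext' fun i => LinearMap.ext_ring ?_
    simp only [LinearMap.comp_apply, LinearMap.single_apply, ← constVec_single, D,
      LinearMap.sub_apply, LinearMap.smul_apply, map_sub, map_smul, LinearMap.id_apply,
      polyExtend_constVec, hρ, hT, X, sub_self, LinearMap.zero_apply]
  have hρB : ρ.comp BB = 0 := by
    refine LinearMap.pi_ext' fun i => LinearMap.ext_ring ?_
    simp only [LinearMap.comp_apply, LinearMap.single_apply, ← constVec_single, BB,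
      polyExtend_constVec, hρ, hεB, LinearMap.zero_apply]
  refine ⟨ρ, BB.coprod D, (-D').prod BB, ?_, ?_, ?_, ?_⟩
  · intro y
    obtain ⟨x, rfl⟩ := hε y
    exact ⟨_, hρ x⟩
  · intro u
    constructor
    · intro hu
      obtain ⟨a, x, rfl⟩ := exists_eq_constVec_add T u
      have h1 : ρ (D x) = 0 := LinearMap.congr_fun hρD x
      have h2 : ρ (constVec a + D x) = 0 := hu
      rw [map_add, h1, add_zero, hρ] at h2
      obtain ⟨b, rfl⟩ := (hBε a).1 h2
      refine ⟨(constVec b, x), ?_⟩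
      simp [BB, polyExtend_constVec, D, X]
    · rintro ⟨⟨y, x⟩, rfl⟩
      have h1 : ρ (D x) = 0 := LinearMap.congr_fun hρD x
      have h2 : ρ (BB y) = 0 := LinearMap.congr_fun hρB y
      simp [h1, h2]
  · rintro ⟨y, x⟩
    constructor
    · intro h
      replace h : BB y + (X • x - polyExtend T x) = 0 := h
      have hx : ∀ j, coeffVec j x = T (coeffVec (j + 1) x) - B (coeffVec (j + 1) y) := by
        intro j
        rw [← coeffVec_polyExtend, ← coeffVec_polyExtend]
        ext i
        have := congrArg (fun u => (u i).coeff (j + 1)) h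
        simp only [Pi.add_apply, Pi.sub_apply, Pi.smul_apply, smul_eq_mul, X, Polynomial.coeff_add,
          Polynomial.coeff_sub, Polynomial.coeff_X_mul, Pi.zero_apply,
          Polynomial.coeff_zero] at this
        simp only [coeffVec, Pi.sub_apply]
        linear_combination this
      obtain ⟨n, hn⟩ := exists_forall_coeffVec_eq_zero x
      have hr : ∀ c j, n ≤ c + j → ∃ b, B b = coeffVec j x := by
        intro c
        induction c with
        | zero => exact fun j hj => ⟨0, by rw [hn j (by omega), map_zero]⟩
        | succ c ih =>
          intro j hj
          obtain ⟨b, hb⟩ := ih (j + 1) (by omega)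
          refine ⟨T' b - coeffVec (j + 1) y, ?_⟩
          rw [map_sub, hx, ← hb]
          congr 1
          exact LinearMap.congr_fun hT' b
      choose b hb using fun j => hr n j (by omega)
      obtain ⟨z, rfl⟩ : ∃ z, BB z = x := by
        refine ⟨∑ j ∈ Finset.range n, (X ^ j) • constVec (b j), ?_⟩
        conv_rhs => rw [eq_sum_constVec hn]
        simp only [map_sum, map_smul, BB, polyExtend_constVec, hb, X]
      refine ⟨z, Prod.ext ?_ rfl⟩
      refine polyExtend_injective hB ?_
      have h1 : BB (D' z) = D (BB z) := LinearMap.congr_fun hD z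
      have h2 : BB y + D (BB z) = 0 := h
      change BB (-D' z) = BB y
      rw [map_neg, h1, eq_comm, eq_neg_iff_add_eq_zero, h2]
    · rintro ⟨z, h⟩
      rw [← h]
      have h1 : BB (D' z) = D (BB z) := LinearMap.congr_fun hD z
      simp [h1]
  · intro u v h
    exact polyExtend_injective hB (congrArg Prod.snd h)

end CharacteristicSequence

section StablyFree

universe u

/-- Finitely generated projective modules over `R` are free. -/
def ProjectivesFree (R : Type u) [CommRing R] : Prop :=
  ∀ (M : Type u) [AddCommGroup M] [Module R M] [Module.Finite R M] [Module.Projective R M],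
    Module.Free R M

theorem Module.Finite.quotient_of_monic_smul_mem {A : Type*} [CommRing A] {r : ℕ}
    {P : Submodule (Polynomial A) (Fin r → Polynomial A)}
    {f : Polynomial A} (hf : f.Monic) (hfP : ∀ x, f • x ∈ P) :
    Module.Finite A ((Fin r → Polynomial A) ⧸ P) := by
  have : Module.Finite A (Polynomial.degreeLT A f.natDegree) :=
    Module.Finite.equiv (Polynomial.degreeLTEquiv A f.natDegree).symm
  nontriviality A
  refine Module.Finite.of_surjective ((P.mkQ.restrictScalars A).comp
    ((Polynomial.degreeLT A f.natDegree).subtype.compLeft (Fin r))) ?_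
  intro y
  obtain ⟨u, rfl⟩ := P.mkQ_surjective y
  refine ⟨fun i => ⟨u i %ₘ f, ?_⟩, ?_⟩
  · rw [Polynomial.mem_degreeLT, ← Polynomial.degree_eq_natDegree hf.ne_zero]
    exact Polynomial.degree_modByMonic_lt _ hf
  · refine (Submodule.Quotient.eq P).2 ?_
    convert P.neg_mem (hfP (fun i => u i /ₘ f)) using 1
    ext1 i
    have := Polynomial.modByMonic_add_div (u i) f
    simp only [LinearMap.compLeft_apply, Function.comp_apply, Submodule.subtype_apply, Pi.sub_apply,
      Pi.neg_apply, Pi.smul_apply, smul_eq_mul]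
    linear_combination this

/-- Projective submodules of a free module over `A[X]` that contain a monic multiple of it are
stably free. -/
theorem exists_free_prod_of_monic_smul_mem {A : Type u} [CommRing A] [IsNoetherianRing A]
    [Nontrivial A]
    (hA : ProjectivesFree A) {r : ℕ} {P : Submodule (Polynomial A) (Fin r → Polynomial A)}
    [Module.Projective (Polynomial A) P] {f : Polynomial A} (hf : f.Monic)
    (hfP : ∀ x, f • x ∈ P) :
    ∃ k s, Module.Free (Polynomial A)
      (P × (Fin k → Polynomial A) × (Fin s → Polynomial A)) := by
  have := Module.Finite.quotient_of_monic_smul_mem hf hfP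
  obtain ⟨k, ε, hε⟩ := Module.Finite.exists_fin' A ((Fin r → Polynomial A) ⧸ P)
  have hP : Module.Projective A P := Module.Projective.restrictScalars A (D := Polynomial A)
  have hQ : Module.Projective A (LinearMap.ker ε) := by
    obtain ⟨e⟩ := schanuel (R := A) (f := ε) (LinearMap.ker ε).injective_subtype
      (LinearMap.exact_subtype_ker_map ε) hε
      (i' := P.subtype.restrictScalars A) (f' := P.mkQ.restrictScalars A)
      P.injective_subtype (LinearMap.exact_subtype_mkQ P) P.mkQ_surjective
    have := Module.Projective.of_equiv e.symm
    exact Module.Projective.of_prod_left (N := Fin r → Polynomial A)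
  have := hA (LinearMap.ker ε)
  obtain ⟨s, ⟨b⟩⟩ : ∃ s, Nonempty (Module.Basis (Fin s) A (LinearMap.ker ε)) :=
    ⟨_, ⟨Module.finBasis A _⟩⟩
  obtain ⟨ρ, φ, i, hρ, hφρ, hiφ, hi⟩ := exists_polynomial_resolution hε
    (B := (LinearMap.ker ε).subtype.comp b.equivFun.symm.toLinearMap)
    (Subtype.val_injective.comp b.equivFun.symm.injective) (by
      rw [LinearMap.exact_iff, LinearMap.range_comp]
      simp)
  obtain ⟨e⟩ := schanuel (i := (LinearMap.range φ).subtype) (f := ρ)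
    (LinearMap.range φ).injective_subtype
    (by rw [LinearMap.exact_iff, Submodule.range_subtype, LinearMap.exact_iff.1 hφρ]) hρ
    P.injective_subtype (LinearMap.exact_subtype_mkQ P) P.mkQ_surjective
  have hW : Module.Projective (Polynomial A) (LinearMap.range φ) := by
    have := Module.Projective.of_equiv e.symm
    exact Module.Projective.of_prod_left (N := Fin r → Polynomial A)
  obtain ⟨e'⟩ := nonempty_prod_equiv_of_exact (p := φ.rangeRestrict) hi
    (by rw [LinearMap.exact_iff, LinearMap.ker_rangeRestrict, LinearMap.exact_iff.1 hiφ])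
    φ.surjective_rangeRestrict
  refine ⟨k, s, ?_⟩
  let D := Polynomial A
  have e1 : ((P × (Fin k → D)) × (Fin s → D)) ≃ₗ[D]
      ((LinearMap.range φ × (Fin r → D)) × (Fin s → D)) := e.symm.prodCongr (.refl _ _)
  have e2 : ((LinearMap.range φ × (Fin r → D)) × (Fin s → D)) ≃ₗ[D]
      (((Fin s → D) × LinearMap.range φ) × (Fin r → D)) :=
    (LinearEquiv.prodComm D _ _).trans (LinearEquiv.prodAssoc D _ _ _).symm
  have e3 : (((Fin s → D) × LinearMap.range φ) × (Fin r → D)) ≃ₗ[D]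
      (((Fin s → D) × (Fin k → D)) × (Fin r → D)) := e'.prodCongr (.refl _ _)
  exact Module.Free.of_equiv
    (((LinearEquiv.prodAssoc D _ _ _).symm.trans e1).trans (e2.trans e3)).symm

theorem Module.Free.of_prod_pi {D : Type*} [CommRing D] [Nontrivial D]
    (hD : ∀ (n : ℕ) (v : Fin n → D), IsUnimodular v → ∀ i, VecEquiv v (Pi.single i 1))
    {P : Type*} [AddCommGroup P] [Module D P] [Module.Finite D P] (k : ℕ)
    (h : Module.Free D (P × (Fin k → D))) : Module.Free D P := by
  induction k with
  | zero => exact Module.Free.of_equiv (LinearEquiv.prodUnique (R := D) (M := P) (M₂ := Fin 0 → D))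
  | succ k ih =>
    refine ih ?_
    let e : (P × (Fin (k + 1) → D)) ≃ₗ[D] (P × (Fin k → D)) × D :=
      ((LinearEquiv.refl D P).prodCongr
        ((Fin.consLinearEquiv D (fun _ : Fin (k + 1) => D)).symm.trans
          (LinearEquiv.prodComm D _ _))).trans (LinearEquiv.prodAssoc D _ _ _).symm
    have := Module.Free.of_equiv e
    exact Module.Free.of_prod_self hD

end StablyFree

section QuillenSuslin

universe u v

/-- Every idempotent matrix over `R` is conjugate to a diagonal matrix of ones and zeros, stated as
a rank factorization. -/
def IdempotentsSplit (R : Type u) [CommRing R] : Prop :=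
  ∀ (m : ℕ) (π : Matrix (Fin m) (Fin m) R), π * π = π →
    ∃ (r : ℕ) (U : Matrix (Fin m) (Fin r) R) (V : Matrix (Fin r) (Fin m) R),
      U * V = π ∧ V * U = 1

theorem ProjectivesFree.idempotentsSplit {R : Type u} [CommRing R] (h : ProjectivesFree R) :
    IdempotentsSplit R := by
  intro m π hπ
  nontriviality R
  let p := toLin' π
  have hp : ∀ x, p (p x) = p x := fun x => by
    rw [← LinearMap.comp_apply, ← toLin'_mul, hπ]
  have hpr : ∀ x : LinearMap.range p, p.rangeRestrict x = x := by
    rintro ⟨_, ⟨x, rfl⟩⟩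
    exact Subtype.ext (hp x)
  have : Module.Projective R (LinearMap.range p) :=
    Module.Projective.of_split (LinearMap.range p).subtype p.rangeRestrict (LinearMap.ext hpr)
  have := h (LinearMap.range p)
  obtain ⟨r, ⟨b⟩⟩ : ∃ r, Nonempty (Module.Basis (Fin r) R (LinearMap.range p)) :=
    ⟨_, ⟨Module.finBasis R _⟩⟩
  refine ⟨r, LinearMap.toMatrix' ((LinearMap.range p).subtype.comp b.equivFun.symm.toLinearMap),
    LinearMap.toMatrix' (b.equivFun.toLinearMap.comp p.rangeRestrict), ?_, ?_⟩
  · rw [← LinearMap.toMatrix'_comp]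
    refine Eq.trans (congrArg _ ?_) (LinearMap.toMatrix'_toLin' π)
    refine LinearMap.ext fun x => ?_
    simp [p]
  · rw [← LinearMap.toMatrix'_comp, ← LinearMap.toMatrix'_id]
    congr 1
    refine LinearMap.ext fun x => ?_
    have := hpr (b.equivFun.symm x)
    simp only [LinearMap.comp_apply, LinearEquiv.coe_coe, Submodule.subtype_apply] at this ⊢
    rw [this, LinearEquiv.apply_symm_apply, LinearMap.id_apply]

theorem IdempotentsSplit.projectivesFree {R : Type u} [CommRing R] (h : IdempotentsSplit R) :
    ProjectivesFree R := by
  intro M _ _ _ _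
  obtain ⟨m, p, i, -, -, hpi⟩ := Module.Finite.exists_comp_eq_id_of_projective R M
  replace hpi : ∀ x, p (i x) = x := LinearMap.congr_fun hpi
  obtain ⟨r, U, V, hUV, hVU⟩ := h m (LinearMap.toMatrix' (i.comp p)) (by
    rw [← LinearMap.toMatrix'_comp]
    congr 1
    refine LinearMap.ext fun x => ?_
    simp [hpi])
  have hUV' : ∀ x, U *ᵥ (V *ᵥ x) = i (p x) := fun x => by
    rw [mulVec_mulVec, hUV, LinearMap.toMatrix'_mulVec, LinearMap.comp_apply]
  refine Module.Free.of_equiv (M := Fin r → R) (LinearEquiv.ofLinearMap (p.comp U.mulVecLin)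
    (V.mulVecLin.comp i) ?_ ?_)
  · ext1 x
    simp [hUV', hpi]
  · refine LinearMap.ext fun x => ?_
    simp only [LinearMap.comp_apply, mulVecLin_apply, LinearMap.id_apply, ← hUV']
    rw [mulVec_mulVec, mulVec_mulVec, hVU, Matrix.one_mul, mulVec_mulVec, hVU, one_mulVec]

theorem IdempotentsSplit.of_ringEquiv {R : Type u} {S : Type v} [CommRing R] [CommRing S]
    (e : R ≃+* S) (h : IdempotentsSplit R) : IdempotentsSplit S := by
  intro m π hπ
  obtain ⟨r, U, V, hUV, hVU⟩ := h m (π.map e.symm) (by rw [← Matrix.map_mul, hπ])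
  refine ⟨r, U.map e, V.map e, ?_, ?_⟩
  · rw [← Matrix.map_mul, hUV, Matrix.map_map]
    ext
    simp
  · rw [← Matrix.map_mul, hVU]
    simp

theorem exists_monic_smul_matrix {A B : Type*} [CommRing A] [CommRing B]
    (g : Polynomial A →+* B)
    (hg : ∀ b : B, ∃ f a : Polynomial A, f.Monic ∧ g a = g f * b) {m r : ℕ}
    (U : Matrix (Fin m) (Fin r) B) :
    ∃ (f : Polynomial A) (U' : Matrix (Fin m) (Fin r) (Polynomial A)), f.Monic ∧
      U'.map g = g f • U := by
  choose f a hf ha using hg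
  let F := ∏ x : Fin m × Fin r, f (U x.1 x.2)
  have hF : ∀ i j, ∃ c, F = f (U i j) * c := fun i j =>
    Finset.dvd_prod_of_mem (fun x : Fin m × Fin r => f (U x.1 x.2)) (Finset.mem_univ (i, j))
  choose c hc using hF
  refine ⟨F, of fun i j => c i j * a (U i j),
    Polynomial.monic_prod_of_monic _ _ fun _ _ => hf _, ?_⟩
  ext i j
  rw [Matrix.map_apply, of_apply, Matrix.smul_apply, smul_eq_mul, hc i j, map_mul, map_mul, ha]
  ring

theorem ProjectivesFree.polynomial {A : Type u} {B : Type v} [CommRing A] [IsDomain A]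
    [IsNoetherianRing A] [CommRing B] (hA : ProjectivesFree A) (hB : IdempotentsSplit B)
    (hD : ∀ (n : ℕ) (v : Fin n → Polynomial A), IsUnimodular v → ∀ i, VecEquiv v (Pi.single i 1))
    {g : Polynomial A →+* B} (hgi : Function.Injective g)
    (hg : ∀ b : B, ∃ f a : Polynomial A, f.Monic ∧ g a = g f * b) :
    ProjectivesFree (Polynomial A) := by
  intro M _ _ _ _
  obtain ⟨m, p, i, -, -, hpi⟩ := Module.Finite.exists_comp_eq_id_of_projective (Polynomial A) M
  replace hpi : ∀ x, p (i x) = x := LinearMap.congr_fun hpi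
  let π := LinearMap.toMatrix' (i.comp p)
  have hπ : ∀ x, π *ᵥ x = i (p x) := fun x => by
    rw [LinearMap.toMatrix'_mulVec, LinearMap.comp_apply]
  have hππ : π * π = π := by
    rw [← LinearMap.toMatrix'_comp]
    congr 1
    refine LinearMap.ext fun x => ?_
    simp [hpi]
  obtain ⟨r, U, V, hUV, hVU⟩ := hB m (π.map g) (by rw [← Matrix.map_mul, hππ])
  obtain ⟨f₁, U', hf₁, hU'⟩ := exists_monic_smul_matrix g hg U
  obtain ⟨f₂, V', hf₂, hV'⟩ := exists_monic_smul_matrix g hg V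
  have hf : (f₁ * f₂).Monic := hf₁.mul hf₂
  have h1 : U' * V' = (f₁ * f₂) • π := by
    refine Matrix.map_injective hgi (?_ : Matrix.map _ g = Matrix.map _ g)
    rw [Matrix.map_mul, hU', hV', Matrix.smul_mul, Matrix.mul_smul, hUV, smul_smul, ← map_mul]
    ext
    simp
  have h2 : V' * π * U' = (f₁ * f₂) • (1 : Matrix (Fin r) (Fin r) (Polynomial A)) := by
    refine Matrix.map_injective hgi (?_ : Matrix.map _ g = Matrix.map _ g)
    rw [Matrix.map_mul, Matrix.map_mul, hU', hV', ← hUV]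
    simp only [Matrix.smul_mul, Matrix.mul_smul, smul_smul, ← map_mul]
    rw [← Matrix.mul_assoc, hVU, Matrix.one_mul, hVU]
    ext i j
    by_cases h : i = j <;> simp [h]
  let α : M →ₗ[Polynomial A] (Fin r → Polynomial A) := V'.mulVecLin.comp i
  have hα : Function.Injective α := by
    rw [injective_iff_map_eq_zero]
    intro x hx
    refine Module.Projective.eq_zero_of_smul_eq_zero (D := Polynomial A)
      (mem_nonZeroDivisors_of_ne_zero hf.ne_zero) ?_
    have h3 : U' *ᵥ (V' *ᵥ i x) = 0 := by
      have : V' *ᵥ i x = 0 := hx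
      rw [this, mulVec_zero]
    rw [mulVec_mulVec, h1, smul_mulVec, hπ, hpi, ← map_smul] at h3
    rw [← hpi ((f₁ * f₂) • x), h3, map_zero]
  let e := LinearEquiv.ofInjective α hα
  have hP : Module.Projective (Polynomial A) (LinearMap.range α) := Module.Projective.of_equiv e
  obtain ⟨k, s, h⟩ := exists_free_prod_of_monic_smul_mem hA (P := LinearMap.range α) hf (by
    intro x
    refine ⟨p (U' *ᵥ x), ?_⟩
    simp only [α, LinearMap.comp_apply, mulVecLin_apply]
    rw [← hπ, mulVec_mulVec, mulVec_mulVec, h2, smul_mulVec, one_mulVec])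
  have h' := Module.Free.of_equiv (LinearEquiv.prodAssoc (Polynomial A) (LinearMap.range α)
    (Fin k → Polynomial A) (Fin s → Polynomial A)).symm
  have := Module.Free.of_prod_pi hD k (Module.Free.of_prod_pi hD s h')
  exact Module.Free.of_equiv e.symm

theorem exists_monic_mul_eq_mvPolynomial (K : Type u) [Field K] (n : ℕ) :
    ∃ g : Polynomial (MvPolynomial (Fin n) K) →+*
        MvPolynomial (Fin n) (FractionRing (Polynomial K)),
      Function.Injective g ∧ ∀ b, ∃ f a, f.Monic ∧ g a = g f * b := by
  let e : MvPolynomial (Fin n) (Polynomial K) ≃ₐ[K] Polynomial (MvPolynomial (Fin n) K) :=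
    (optionEquivRight K (Fin n)).symm.trans (optionEquivLeft K (Fin n))
  have he : ∀ q, e (C q) = q.map (C : K →+* MvPolynomial (Fin n) K) := by
    intro q
    have : (e.toRingEquiv.toRingHom.comp C) = Polynomial.mapRingHom C := by
      ext1
      · ext1 c
        have := e.commutes c
        simpa [MvPolynomial.algebraMap_eq, MvPolynomial.algebraMap_apply] using this
      · simp [e]
    exact RingHom.congr_fun this q
  let g₀ := MvPolynomial.map (σ := Fin n)
    (algebraMap (Polynomial K) (FractionRing (Polynomial K)))
  refine ⟨g₀.comp e.symm.toRingEquiv.toRingHom,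
    (map_injective _ (IsFractionRing.injective _ _)).comp e.symm.injective, fun b => ?_⟩
  obtain ⟨⟨q, hq⟩, hqb⟩ : ∃ q : nonZeroDivisors (Polynomial K), ∃ a, g₀ a = g₀ (C q.1) * b := by
    induction b using MvPolynomial.induction_on with
    | C x =>
      obtain ⟨⟨a, q⟩, h⟩ := IsLocalization.surj (nonZeroDivisors (Polynomial K)) x
      refine ⟨q, C a, ?_⟩
      simp only [g₀, map_C, ← h, map_mul]
      ring
    | add x y hx hy =>
      obtain ⟨q, a, h⟩ := hx
      obtain ⟨q', a', h'⟩ := hy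
      refine ⟨q * q', C q'.1 * a + C q.1 * a', ?_⟩
      simp only [map_add, map_mul, h, h', Submonoid.coe_mul]
      ring
    | mul_X x i hx =>
      obtain ⟨q, a, h⟩ := hx
      refine ⟨q, a * X i, ?_⟩
      rw [map_mul, h, mul_assoc]
      simp [g₀]
  obtain ⟨a, h⟩ := hqb
  have hq0 : q ≠ 0 := nonZeroDivisors.ne_zero hq
  let c := Polynomial.C q.leadingCoeff⁻¹
  refine ⟨e (C (q * c)), e (C c * a), ?_, ?_⟩
  · rw [he]
    exact (Polynomial.monic_mul_leadingCoeff_inv hq0).map _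
  · have h' : ∀ x, (g₀.comp e.symm.toRingEquiv.toRingHom) (e x) = g₀ x := fun x =>
      congrArg g₀ (e.symm_apply_apply x)
    rw [h', h', map_mul, h, map_mul C, map_mul]
    ring

/-- The **Quillen–Suslin theorem**: idempotent matrices over polynomial rings split. -/
theorem idempotentsSplit_mvPolynomial (n : ℕ) :
    ∀ (K : Type u) [Field K], IdempotentsSplit (MvPolynomial (Fin n) K) := by
  induction n with
  | zero =>
    intro K _
    refine IdempotentsSplit.of_ringEquiv (isEmptyRingEquiv K (Fin 0)).symm ?_
    exact ProjectivesFree.idempotentsSplit fun M _ _ _ _ => inferInstance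
  | succ n ih =>
    intro K _
    refine IdempotentsSplit.of_ringEquiv (finSuccEquiv K n).symm.toRingEquiv ?_
    obtain ⟨g, hgi, hg⟩ := exists_monic_mul_eq_mvPolynomial K n
    refine ((ih K).projectivesFree.polynomial (ih _) (fun m v hv i => ?_) hgi hg).idempotentsSplit
    let e := (finSuccEquiv K n).symm.toRingEquiv
    refine VecEquiv.of_ringEquiv e ?_
    have h1 : e ∘ (Pi.single i 1 : Fin m → Polynomial (MvPolynomial (Fin n) K)) =
        Pi.single i 1 := by
      ext1 j
      by_cases h : j = i <;> simp [h]
    rw [h1]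
    exact IsUnimodular.vecEquiv_single (n + 1)
      (hv.map (e : Polynomial (MvPolynomial (Fin n) K) →+* MvPolynomial (Fin (n + 1)) K)) i

end QuillenSuslin

section Minors

variable {R : Type*} [CommRing R] {l m : ℕ}

theorem exists_det_submatrix_eq_mul (M : Matrix (Fin l) (Fin m) R) {ri : Fin l → Fin l}
    (hri : Function.Injective ri) (ci : Fin l → Fin m) :
    ∃ ε : R, ε * ε = 1 ∧ (M.submatrix ri ci).det = ε * (M.submatrix id ci).det := by
  let σ := Equiv.ofBijective ri (Finite.injective_iff_bijective.1 hri)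
  refine ⟨((Equiv.Perm.sign σ : ℤ) : R), ?_, ?_⟩
  · rw [← Int.cast_mul, ← Units.val_mul, Int.units_mul_self]
    simp
  · rw [← det_permute]
    rfl

theorem det_submatrix_eq_zero_or_mem (F : Matrix (Fin l) (Fin m) R) (g : Fin l → Fin m) :
    (F.submatrix id g).det = 0 ∨ (F.submatrix id g).det ∈ minorsSet l F := by
  by_cases hg : Function.Injective g
  · exact Or.inr ⟨id, g, Function.injective_id, hg, rfl⟩
  · simp only [Function.Injective, not_forall] at hg
    obtain ⟨i, j, h, hij⟩ := hg
    exact Or.inl (det_zero_of_column_eq hij fun k => by simp [h])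

theorem det_mul_mem_span_minorsSet (F : Matrix (Fin l) (Fin m) R) (N : Matrix (Fin m) (Fin l) R) :
    (F * N).det ∈ Ideal.span (minorsSet l F) := by
  have h : (F * N)ᵀ = fun i => ∑ k, N k i • Fᵀ k := by
    ext i j
    simp [mul_apply, mul_comm]
  rw [← det_transpose, h]
  change (detRowAlternating (R := R) (n := Fin l)).toMultilinearMap _ ∈ _
  rw [MultilinearMap.map_sum]
  refine Ideal.sum_mem _ fun f _ => ?_
  rw [MultilinearMap.map_smul_univ]
  refine Ideal.mul_mem_left _ _ ?_
  have : (detRowAlternating (R := R) (n := Fin l)).toMultilinearMap (fun i => Fᵀ (f i)) =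
      (F.submatrix id f).det := by
    rw [← det_transpose]
    rfl
  rw [this]
  rcases det_submatrix_eq_zero_or_mem F f with h0 | h0
  · rw [h0]
    exact Ideal.zero_mem _
  · exact Ideal.subset_span h0

theorem det_dvd_of_mem_minorsSet_mul (G : Matrix (Fin l) (Fin l) R) (V : Matrix (Fin l) (Fin m) R)
    {a : R} (ha : a ∈ minorsSet l (G * V)) : G.det ∣ a := by
  obtain ⟨ri, ci, hri, -, rfl⟩ := ha
  obtain ⟨ε, -, h⟩ := exists_det_submatrix_eq_mul (G * V) hri ci
  rw [h, ← submatrix_mul_equiv G V id (Equiv.refl _) ci, det_mul]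
  exact Dvd.dvd.mul_left (Dvd.intro _ rfl) _

/-- A combination of the reduced maximal minors of `F` gives a matrix that is a right inverse of `F`
up to a multiple of the greatest common divisor of the minors. -/
theorem exists_mul_eq_smul_one {F : Matrix (Fin l) (Fin m) R} {d : R}
    (hd : ∀ a ∈ minorsSet l F, d ∣ a) {c : R}
    (hc : c ∈ Ideal.span { b : R | d * b ∈ minorsSet l F }) :
    ∃ (E : Matrix (Fin m) (Fin l) R) (π : Matrix (Fin m) (Fin m) R),
      F * E = (d * c) • (1 : Matrix (Fin l) (Fin l) R) ∧ E * F = d • π := by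
  have hd' : ∀ g : Fin l → Fin m, d ∣ (F.submatrix id g).det := fun g => by
    rcases det_submatrix_eq_zero_or_mem F g with h | h
    · rw [h]
      exact dvd_zero d
    · exact hd _ h
  induction hc using Submodule.span_induction with
  | mem b hb =>
    obtain ⟨ri, ci, hri, -, hb⟩ := hb
    obtain ⟨ε, -, h⟩ := exists_det_submatrix_eq_mul F hri ci
    let M := F.submatrix id ci
    let S := (1 : Matrix (Fin m) (Fin m) R).submatrix id ci
    have hFS : F * S = M := by
      ext i j
      simp [S, M, mul_apply, one_apply]
    have hdvd : ∀ i q, d ∣ (M.adjugate * F) i q := by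
      intro i q
      have h1 : (M.adjugate * F) i q = (M.updateCol i (fun k => F k q)).det := by
        rw [← cramer_apply, cramer_eq_adjugate_mulVec]
        rfl
      have h2 : M.updateCol i (fun k => F k q) = F.submatrix id (Function.update ci i q) := by
        ext a b
        by_cases hbi : b = i
        · subst hbi
          simp
        · simp [hbi, M]
      rw [h1, h2]
      exact hd' _
    choose Q hQ using hdvd
    refine ⟨ε • (S * M.adjugate), ε • (S * of Q), ?_, ?_⟩
    · rw [Matrix.mul_smul, ← Matrix.mul_assoc, hFS, mul_adjugate, smul_smul, hb, h]
    · have : M.adjugate * F = d • of Q := by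
        ext i q
        simp [hQ]
      rw [Matrix.smul_mul, Matrix.mul_assoc, this, Matrix.mul_smul, smul_comm]
  | zero => exact ⟨0, 0, by simp, by simp⟩
  | add x y _ _ hx hy =>
    obtain ⟨E, π, h1, h2⟩ := hx
    obtain ⟨E', π', h1', h2'⟩ := hy
    exact ⟨E + E', π + π', by rw [Matrix.mul_add, h1, h1', mul_add, add_smul],
      by rw [Matrix.add_mul, h2, h2', smul_add]⟩
  | smul r x _ hx =>
    obtain ⟨E, π, h1, h2⟩ := hx
    refine ⟨r • E, r • π, ?_, by rw [Matrix.smul_mul, h2, smul_comm]⟩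
    rw [Matrix.mul_smul, h1, smul_smul, smul_eq_mul, mul_left_comm]

theorem exists_mul_eq_one_of_rank_eq {L : Type*} [Field L] {F : Matrix (Fin l) (Fin m) L}
    (h : F.rank = l) : ∃ N : Matrix (Fin m) (Fin l) L, F * N = 1 := by
  have ht : LinearMap.range F.mulVecLin = ⊤ := by
    apply Submodule.eq_top_of_finrank_eq
    rw [Module.finrank_fin_fun]
    exact h
  obtain ⟨N, hN⟩ := LinearMap.exists_rightInverse_of_surjective _ ht
  refine ⟨LinearMap.toMatrix' N, ?_⟩
  have := congrArg LinearMap.toMatrix' hN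
  rwa [LinearMap.toMatrix'_comp, LinearMap.toMatrix'_id, ← toLin'_apply',
    LinearMap.toMatrix'_toLin'] at this

theorem eq_of_mul_eq_smul_one [IsDomain R] {d : R} (hd : d ≠ 0) {M : Matrix (Fin l) (Fin m) R}
    {N : Matrix (Fin m) (Fin l) R} (h : M * N = d • (1 : Matrix (Fin l) (Fin l) R))
    (h' : N * M = d • (1 : Matrix (Fin m) (Fin m) R)) : l = m := by
  let f := algebraMap R (FractionRing R)
  have hfd : f d ≠ 0 := by
    rwa [Ne, map_eq_zero_iff f (IsFractionRing.injective R (FractionRing R))]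
  have h1 : (f d)⁻¹ • M.map f * N.map f = 1 := by
    rw [Matrix.smul_mul, ← Matrix.map_mul, h]
    ext i j
    by_cases hij : i = j <;> simp [hij, hfd, one_apply]
  have h2 : N.map f * (f d)⁻¹ • M.map f = 1 := by
    rw [Matrix.mul_smul, ← Matrix.map_mul, h']
    ext i j
    by_cases hij : i = j <;> simp [hij, hfd, one_apply]
  simpa using square_of_invertible _ _ h1 h2

end Minors

theorem ne_zero_of_normalRank_eq {K : Type*} [Field K] {n l m : ℕ}
    {F : Matrix (Fin l) (Fin m) (MvPolynomial (Fin n) K)} (hfull : normalRank F = l)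
    {d : MvPolynomial (Fin n) K} (hd : ∀ a ∈ minorsSet l F, d ∣ a) : d ≠ 0 := by
  rintro rfl
  obtain ⟨N, hN⟩ := exists_mul_eq_one_of_rank_eq hfull
  have h := det_mul_mem_span_minorsSet
    (F.map (algebraMap (MvPolynomial (Fin n) K) (FractionRing (MvPolynomial (Fin n) K)))) N
  rw [hN, det_one] at h
  have h0 : Ideal.span (minorsSet l (F.map (algebraMap (MvPolynomial (Fin n) K)
      (FractionRing (MvPolynomial (Fin n) K))))) = ⊥ := by
    rw [Ideal.span_eq_bot]
    rintro _ ⟨ri, ci, hri, hci, rfl⟩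
    rw [submatrix_map, ← RingHom.mapMatrix_apply, ← RingHom.map_det,
      zero_dvd_iff.1 (hd _ ⟨ri, ci, hri, hci, rfl⟩), map_zero]
  rw [h0] at h
  exact one_ne_zero h

/-- If `F ∈ R^{l×m}` (`l ≤ m`) has full row rank and `J_l(F) = R`, then
`F = G * F₁` with `G ∈ R^{l×l}`, `det G` associated to `d_l(F)`, and `F₁` ZLP. -/
theorem statement12 {K : Type*} [Field K] {n l m : ℕ} (hlm : l ≤ m)
    (F : Matrix (Fin l) (Fin m) (MvPolynomial (Fin n) K))
    (hfull : normalRank F = l)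
    (hJ : JEqTop l F) :
    ∃ (G : Matrix (Fin l) (Fin l) (MvPolynomial (Fin n) K))
      (F1 : Matrix (Fin l) (Fin m) (MvPolynomial (Fin n) K)),
      F = G * F1 ∧ (∀ d, IsGcdMinors l F d → Associated G.det d) ∧ ZLP F1 := by
  obtain ⟨d, ⟨hd, -⟩, htop⟩ := hJ
  have hd0 : d ≠ 0 := ne_zero_of_normalRank_eq hfull hd
  obtain ⟨E, π, hFE, hEF⟩ := exists_mul_eq_smul_one hd (c := 1) (by rw [htop]; trivial)
  rw [mul_one] at hFE
  have hFπ : F * π = F := by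
    refine smul_right_injective _ hd0 (?_ : d • _ = d • _)
    rw [← Matrix.mul_smul, ← hEF, ← Matrix.mul_assoc, hFE, Matrix.smul_mul, Matrix.one_mul]
  have hππ : π * π = π := by
    refine smul_right_injective _ hd0 (?_ : d • _ = d • _)
    rw [← Matrix.smul_mul, ← hEF, Matrix.mul_assoc, hFπ]
  obtain ⟨r, U, V, hUV, hVU⟩ := idempotentsSplit_mvPolynomial n K m π hππ
  obtain rfl : l = r := by
    refine eq_of_mul_eq_smul_one hd0 (M := F * U) (N := V * E) ?_ ?_
    · rw [Matrix.mul_assoc, ← Matrix.mul_assoc U, hUV, ← Matrix.mul_assoc, hFπ, hFE]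
    · rw [Matrix.mul_assoc, ← Matrix.mul_assoc E, hEF, ← hUV, Matrix.smul_mul, Matrix.mul_smul,
        Matrix.mul_assoc U, hVU, Matrix.mul_one, hVU]
  have hF : F = F * U * V := by rw [Matrix.mul_assoc, hUV, hFπ]
  refine ⟨F * U, V, hF, fun d' hd' => associated_of_dvd_dvd ?_ ?_, ?_⟩
  · refine hd'.2 _ fun a ha => ?_
    rw [hF] at ha
    exact det_dvd_of_mem_minorsSet_mul _ _ ha
  · rw [← Ideal.mem_span_singleton]
    exact Ideal.span_le.2 (fun a ha => Ideal.mem_span_singleton.2 (hd'.1 a ha))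
      (det_mul_mem_span_minorsSet F U)
  · rw [ZLP, Ideal.eq_top_iff_one]
    have := det_mul_mem_span_minorsSet V U
    rwa [hVU, det_one] at this
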